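/- arXiv:1403.0478 — 8 statements merged into one kernel-verified Lean document; each statement's English description precedes it below -/
import Mathlib

section
/- Theorem (Six-Point Ceva–Menelaus, part a). Assume that the three lines B⁺C⁻, C⁺A⁻, A⁺B⁻ are pairwise non-parallel, i.e. the direction vectors C⁻ − B⁺, A⁻ − C⁺, B⁻ − A⁺ are pairwise linearly independent. Then the three lines pass through a common point if and only if a⁺·b⁺·c⁺ + a⁻·b⁻·c⁻ = 1 − a⁺·a⁻ − b⁺·b⁻ − c⁺·c⁻. -/
/-- The line through two points `P Q : ℝ × ℝ`, as the affine span of `{P, Q}`. -/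
noncomputable def line (P Q : ℝ × ℝ) : AffineSubspace ℝ (ℝ × ℝ) := affineSpan ℝ {P, Q}

/-- The planar cross product, i.e. the determinant of the pair `u, v`. -/
def cross (u v : ℝ × ℝ) : ℝ := u.1 * v.2 - u.2 * v.1

theorem linearIndependent_pair_iff_cross_ne_zero (u v : ℝ × ℝ) :
    LinearIndependent ℝ ![u, v] ↔ cross u v ≠ 0 := by
  rw [LinearIndependent.pair_iff]
  constructor
  · intro h h0
    simp only [cross] at h0
    have e1 := h v.1 (-u.1) (by ext <;> simp <;> linarith)
    have e2 := h v.2 (-u.2) (by ext <;> simp <;> linarith)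
    have hu : u = 0 := Prod.ext (by simpa using e1.2) (by simpa using e2.2)
    exact one_ne_zero (h 1 0 (by simp [hu])).1
  · intro h s t hst
    have e1 := congrArg Prod.fst hst
    have e2 := congrArg Prod.snd hst
    simp at e1 e2
    constructor
    · apply (mul_eq_zero.1 (?_ : s * cross u v = 0)).resolve_right h
      simp only [cross]
      linear_combination v.2 * e1 - v.1 * e2
    · apply (mul_eq_zero.1 (?_ : t * cross u v = 0)).resolve_right h
      simp only [cross]
      linear_combination u.1 * e2 - u.2 * e1

theorem cross_ne_zero_of_affineIndependent {A B C : ℝ × ℝ}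
    (h : AffineIndependent ℝ ![A, B, C]) : cross (B - A) (C - A) ≠ 0 := by
  rw [affineIndependent_iff_linearIndependent_vsub ℝ _ (0 : Fin 3),
    ← linearIndependent_equiv (finSuccAboveEquiv (0 : Fin 3))] at h
  rw [← linearIndependent_pair_iff_cross_ne_zero]
  have e : ![B - A, C - A] = (fun i : {x : Fin 3 // x ≠ 0} => ![A, B, C] i -ᵥ ![A, B, C] 0) ∘
      finSuccAboveEquiv (0 : Fin 3) := by
    funext i
    fin_cases i <;> rfl
  rw [e]
  exact h

theorem mem_line_iff_cross_eq_zero {P Q R : ℝ × ℝ} (h : R - Q ≠ 0) :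
    P ∈ line Q R ↔ cross (R - Q) (P - Q) = 0 := by
  rw [line, mem_affineSpan_pair_iff_exists_lineMap_eq]
  constructor
  · rintro ⟨r, rfl⟩
    simp [cross, AffineMap.lineMap_apply]
    ring
  · intro h0
    simp only [cross, Prod.fst_sub, Prod.snd_sub] at h0
    have key : R.1 - Q.1 ≠ 0 ∨ R.2 - Q.2 ≠ 0 := by
      by_contra! hc
      exact h (Prod.ext hc.1 hc.2)
    rcases key with hk | hk
    · refine ⟨(P.1 - Q.1) / (R.1 - Q.1), ?_⟩
      ext <;> simp [AffineMap.lineMap_apply] <;> field_simp <;> linarith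
    · refine ⟨(P.2 - Q.2) / (R.2 - Q.2), ?_⟩
      ext <;> simp [AffineMap.lineMap_apply] <;> field_simp <;> linarith

/-- The equation, in the barycentric coordinates of the triangle `A B C`, of the line through a
point of the edge-line `CA` and a point of the edge-line `BA`. -/
theorem mem_line_edge_points_iff {A B C P Q R : ℝ × ℝ} {b c : ℝ}
    (hb : 1 + b ≠ 0) (hc : 1 + c ≠ 0)
    (hQ : Q = (1 + b)⁻¹ • (C + b • A)) (hR : R = (1 + c)⁻¹ • (B + c • A)) (h : R - Q ≠ 0) :
    P ∈ line Q R ↔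
      c * cross (C - P) (A - P) + b * cross (A - P) (B - P) = cross (B - P) (C - P) := by
  have key : (1 + b) * (1 + c) * cross (R - Q) (P - Q) =
      c * cross (C - P) (A - P) + b * cross (A - P) (B - P) - cross (B - P) (C - P) := by
    subst hQ hR
    simp [cross]
    field_simp
    ring
  rw [mem_line_iff_cross_eq_zero h, ← mul_right_inj' (mul_ne_zero hb hc), key, mul_zero,
    sub_eq_zero]

/-- **Six-Point Ceva–Menelaus theorem, part a.** If the lines `B⁺C⁻`, `C⁺A⁻`,
`A⁺B⁻` are pairwise non-parallel, they are concurrent iff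
`a⁺b⁺c⁺ + a⁻b⁻c⁻ = 1 - a⁺a⁻ - b⁺b⁻ - c⁺c⁻`. -/
theorem six_point_ceva_menelaus_a (A B C : ℝ × ℝ)
    (hABC : AffineIndependent ℝ ![A, B, C])
    (ap am bp bm cp cm : ℝ)
    (hap : 1 + ap ≠ 0) (ham : 1 + am ≠ 0) (hbp : 1 + bp ≠ 0)
    (hbm : 1 + bm ≠ 0) (hcp : 1 + cp ≠ 0) (hcm : 1 + cm ≠ 0)
    (Ap Am Bp Bm Cp Cm : ℝ × ℝ)
    (hAp : Ap = (1 + ap)⁻¹ • (B + ap • C))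
    (hAm : Am = (1 + am)⁻¹ • (C + am • B))
    (hBp : Bp = (1 + bp)⁻¹ • (C + bp • A))
    (hBm : Bm = (1 + bm)⁻¹ • (A + bm • C))
    (hCp : Cp = (1 + cp)⁻¹ • (A + cp • B))
    (hCm : Cm = (1 + cm)⁻¹ • (B + cm • A))
    (h1 : LinearIndependent ℝ ![Cm - Bp, Am - Cp])
    (h2 : LinearIndependent ℝ ![Am - Cp, Bm - Ap])
    (h3 : LinearIndependent ℝ ![Bm - Ap, Cm - Bp]) :
    (∃ P : ℝ × ℝ, P ∈ line Bp Cm ∧ P ∈ line Cp Am ∧ P ∈ line Ap Bm) ↔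
    ap * bp * cp + am * bm * cm = 1 - ap * am - bp * bm - cp * cm := by
  have hD := cross_ne_zero_of_affineIndependent hABC
  have hdet := (linearIndependent_pair_iff_cross_ne_zero _ _).1 h1
  simp only [mem_line_edge_points_iff hbp hcm hBp hCm (h1.ne_zero 0),
    mem_line_edge_points_iff hcp ham hCp hAm (h1.ne_zero 1),
    mem_line_edge_points_iff hap hbm hAp hBm (h2.ne_zero 1)]
  constructor
  · rintro ⟨P, e1, e2, e3⟩
    have hsum : cross (B - A) (C - A) =
        cross (B - P) (C - P) + cross (C - P) (A - P) + cross (A - P) (B - P) := by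
      simp [cross]
      ring
    rw [← sub_eq_zero]
    refine (mul_eq_zero.1 (?_ : cross (B - A) (C - A) * _ = 0)).resolve_left hD
    rw [hsum]
    generalize cross (B - P) (C - P) = x at *
    generalize cross (C - P) (A - P) = y at *
    generalize cross (A - P) (B - P) = z at *
    linear_combination
      ((1 - ap * am) + (cp + am * bm) + (cp * ap + bm)) * e1 +
      ((cm + bp * ap) + (1 - bp * bm) + (ap + cm * bm)) * e2 +
      ((cm * am + bp) + (am + bp * cp) + (1 - cm * cp)) * e3
  · intro hE
    set x := cm * am + bp with hx
    set y := am + bp * cp with hy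
    set z := 1 - cm * cp with hz
    have hs : x + y + z ≠ 0 := by
      intro hs
      have hscale : (1 + bp) * (1 + cm) * (1 + cp) * (1 + am) * cross (Cm - Bp) (Am - Cp) =
          (x + y + z) * cross (B - A) (C - A) := by
        subst hBp hCm hCp hAm
        simp [cross, hx, hy, hz]
        field_simp
        ring
      rw [hs, zero_mul] at hscale
      exact mul_ne_zero (mul_ne_zero (mul_ne_zero (mul_ne_zero hbp hcm) hcp) ham) hdet hscale
    set P : ℝ × ℝ := (x + y + z)⁻¹ • (x • A + y • B + z • C) with hP
    have hPA : cross (B - P) (C - P) = x * (cross (B - A) (C - A) / (x + y + z)) := by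
      clear_value x y z
      simp [hP, cross]
      field_simp
      ring
    have hPB : cross (C - P) (A - P) = y * (cross (B - A) (C - A) / (x + y + z)) := by
      clear_value x y z
      simp [hP, cross]
      field_simp
      ring
    have hPC : cross (A - P) (B - P) = z * (cross (B - A) (C - A) / (x + y + z)) := by
      clear_value x y z
      simp [hP, cross]
      field_simp
      ring
    refine ⟨P, ?_⟩
    rw [hPA, hPB, hPC]
    generalize cross (B - A) (C - A) / (x + y + z) = t
    refine ⟨?_, ?_, ?_⟩
    · rw [hx, hy, hz]; ring
    · rw [hx, hy, hz]; ring
    · rw [hx, hy, hz]; linear_combination t * hE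
end

section
/- Theorem (Six-Point Ceva–Menelaus, part b; Bényi–Ćurgus). Suppose X is a point lying on both line BB⁻ and line CC⁺, Y is a point lying on both line CC⁻ and line AA⁺, and Z is a point lying on both line AA⁻ and line BB⁺, where in each case the two lines are non-parallel (their direction vectors are linearly independent). Then X, Y, Z are collinear if and only if a⁺·b⁺·c⁺ + a⁻·b⁻·c⁻ = −1 + a⁺·a⁻ + b⁺·b⁻ + c⁺·c⁻. -/
/-- Three points of the plane are collinear iff the cross product of their differences vanishes. -/
theorem collinear_iff_cross_eq_zero (P Q R : ℝ × ℝ) :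
    Collinear ℝ {P, Q, R} ↔
      (Q.1 - P.1) * (R.2 - P.2) - (Q.2 - P.2) * (R.1 - P.1) = 0 := by
  rw [collinear_iff_of_mem (p₀ := P) (by simp)]
  constructor
  · rintro ⟨v, hv⟩
    obtain ⟨q, hq⟩ := hv Q (by simp)
    obtain ⟨r, hr⟩ := hv R (by simp)
    simp only [hq, hr, vadd_eq_add, Prod.fst_add, Prod.snd_add, Prod.smul_fst, Prod.smul_snd,
      smul_eq_mul]
    ring
  · intro h
    by_cases hQ : Q = P
    · refine ⟨R - P, ?_⟩
      simp only [Set.mem_insert_iff, Set.mem_singleton_iff, forall_eq_or_imp, forall_eq]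
      exact ⟨⟨0, by simp⟩, ⟨0, by simp [hQ]⟩, ⟨1, by simp⟩⟩
    · refine ⟨Q - P, ?_⟩
      simp only [Set.mem_insert_iff, Set.mem_singleton_iff, forall_eq_or_imp, forall_eq]
      refine ⟨⟨0, by simp⟩, ⟨1, by simp⟩, ?_⟩
      by_cases h1 : Q.1 - P.1 = 0
      · have h2 : Q.2 - P.2 ≠ 0 := fun h2 =>
          hQ (Prod.ext (sub_eq_zero.mp h1) (sub_eq_zero.mp h2))
        refine ⟨(R.2 - P.2) / (Q.2 - P.2), Prod.ext ?_ ?_⟩ <;> simp <;> field_simp <;> linarith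
      · refine ⟨(R.1 - P.1) / (Q.1 - P.1), Prod.ext ?_ ?_⟩ <;> simp <;> field_simp <;> linarith

/-- A common point of the cevians from `B` and `C` whose feet are `(1 + s)⁻¹ • (A + s • C)` and
`(1 + t)⁻¹ • (A + t • B)` has barycentric coordinates `1 : t : s`. -/
theorem cevian_inter_barycentric {A B C X : ℝ × ℝ} {s t : ℝ}
    (hABC : (B.1 - A.1) * (C.2 - A.2) - (B.2 - A.2) * (C.1 - A.1) ≠ 0)
    (hs : 1 + s ≠ 0) (ht : 1 + t ≠ 0)
    (hB : X ∈ line B ((1 + s)⁻¹ • (A + s • C)))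
    (hC : X ∈ line C ((1 + t)⁻¹ • (A + t • B))) :
    ∃ k : ℝ, k * (1 + t + s) = 1 ∧ X = k • (A + t • B + s • C) := by
  obtain ⟨r, hr⟩ := mem_affineSpan_pair_iff_exists_lineMap_eq.mp hB
  obtain ⟨q, hq⟩ := mem_affineSpan_pair_iff_exists_lineMap_eq.mp hC
  obtain ⟨k, rfl⟩ : ∃ k, r = k * (1 + s) := ⟨r / (1 + s), by field_simp⟩
  obtain ⟨l, rfl⟩ : ∃ l, q = l * (1 + t) := ⟨q / (1 + t), by field_simp⟩
  have hr1 := congrArg Prod.fst hr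
  have hr2 := congrArg Prod.snd hr
  have hq1 := congrArg Prod.fst hq
  have hq2 := congrArg Prod.snd hq
  simp only [AffineMap.lineMap_apply, vsub_eq_sub, vadd_eq_add, Prod.fst_add, Prod.snd_add,
    Prod.fst_sub, Prod.snd_sub, Prod.smul_fst, Prod.smul_snd, smul_eq_mul] at hr1 hr2 hq1 hq2
  field_simp at hr1 hr2 hq1 hq2
  have hkl : k = l := by
    refine sub_eq_zero.mp (mul_right_cancel₀ hABC ?_)
    linear_combination (B.2 - C.2) * (hr1 - hq1) - (B.1 - C.1) * (hr2 - hq2)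
  subst hkl
  have hk : k * (1 + t + s) = 1 := by
    refine sub_eq_zero.mp (mul_right_cancel₀ hABC ?_)
    linear_combination (A.2 - C.2) * (hr1 - hq1) - (A.1 - C.1) * (hr2 - hq2)
  refine ⟨k, hk, Prod.ext ?_ ?_⟩
  · simp only [Prod.fst_add, Prod.smul_fst, smul_eq_mul]
    linear_combination -hr1 - B.1 * hk
  · simp only [Prod.snd_add, Prod.smul_snd, smul_eq_mul]
    linear_combination -hr2 - B.2 * hk

/-- **Six-Point Ceva–Menelaus theorem, part b (Bényi–Ćurgus).** The intersection
points `X = BB⁻ ∩ CC⁺`, `Y = CC⁻ ∩ AA⁺`, `Z = AA⁻ ∩ BB⁺` are collinear iff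
`a⁺b⁺c⁺ + a⁻b⁻c⁻ = -1 + a⁺a⁻ + b⁺b⁻ + c⁺c⁻`. -/
theorem six_point_ceva_menelaus_b (A B C : ℝ × ℝ)
    (hABC : AffineIndependent ℝ ![A, B, C])
    (ap am bp bm cp cm : ℝ)
    (hap : 1 + ap ≠ 0) (ham : 1 + am ≠ 0) (hbp : 1 + bp ≠ 0)
    (hbm : 1 + bm ≠ 0) (hcp : 1 + cp ≠ 0) (hcm : 1 + cm ≠ 0)
    (Ap Am Bp Bm Cp Cm : ℝ × ℝ)
    (hAp : Ap = (1 + ap)⁻¹ • (B + ap • C))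
    (hAm : Am = (1 + am)⁻¹ • (C + am • B))
    (hBp : Bp = (1 + bp)⁻¹ • (C + bp • A))
    (hBm : Bm = (1 + bm)⁻¹ • (A + bm • C))
    (hCp : Cp = (1 + cp)⁻¹ • (A + cp • B))
    (hCm : Cm = (1 + cm)⁻¹ • (B + cm • A))
    (X Y Z : ℝ × ℝ)
    (hX : X ∈ line B Bm ∧ X ∈ line C Cp)
    (hY : Y ∈ line C Cm ∧ Y ∈ line A Ap)
    (hZ : Z ∈ line A Am ∧ Z ∈ line B Bp)
    (hX' : LinearIndependent ℝ ![Bm - B, Cp - C])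
    (hY' : LinearIndependent ℝ ![Cm - C, Ap - A])
    (hZ' : LinearIndependent ℝ ![Am - A, Bp - B]) :
    Collinear ℝ {X, Y, Z} ↔
    ap * bp * cp + am * bm * cm = -1 + ap * am + bp * bm + cp * cm := by
  rw [affineIndependent_iff_not_collinear_set, collinear_iff_cross_eq_zero] at hABC
  subst hAp hAm hBp hBm hCp hCm
  obtain ⟨x, hx, rfl⟩ := cevian_inter_barycentric hABC hbm hcp hX.1 hX.2
  obtain ⟨y, hy, rfl⟩ := cevian_inter_barycentric
    (fun h => hABC (by linear_combination h)) hcm hap hY.1 hY.2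
  obtain ⟨z, hz, rfl⟩ := cevian_inter_barycentric
    (fun h => hABC (by linear_combination h)) ham hbp hZ.1 hZ.2
  have hx0 : x ≠ 0 := left_ne_zero_of_mul_eq_one hx
  have hy0 : y ≠ 0 := left_ne_zero_of_mul_eq_one hy
  have hz0 : z ≠ 0 := left_ne_zero_of_mul_eq_one hz
  have key : ∀ X Y Z : ℝ × ℝ, X = x • (A + cp • B + bm • C) → Y = y • (B + ap • C + cm • A) →
      Z = z • (C + bp • A + am • B) →
      (Y.1 - X.1) * (Z.2 - X.2) - (Y.2 - X.2) * (Z.1 - X.1) =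
        x * y * z * ((B.1 - A.1) * (C.2 - A.2) - (B.2 - A.2) * (C.1 - A.1)) *
          (ap * bp * cp + am * bm * cm - (-1 + ap * am + bp * bm + cp * cm)) := by
    intro X Y Z hX hY hZ
    have hcross : (Y.1 - X.1) * (Z.2 - X.2) - (Y.2 - X.2) * (Z.1 - X.1) =
        (X.1 * Y.2 - X.2 * Y.1) * (z * (1 + bp + am)) +
          (Y.1 * Z.2 - Y.2 * Z.1) * (x * (1 + cp + bm)) +
          (Z.1 * X.2 - Z.2 * X.1) * (y * (1 + ap + cm)) := by
      rw [hx, hy, hz]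
      ring
    rw [hcross, hX, hY, hZ]
    simp only [Prod.fst_add, Prod.snd_add, Prod.smul_fst, Prod.smul_snd, smul_eq_mul]
    ring
  rw [collinear_iff_cross_eq_zero, key _ _ _ rfl rfl rfl, mul_eq_zero, sub_eq_zero]
  exact or_iff_right (mul_ne_zero (mul_ne_zero (mul_ne_zero hx0 hy0) hz0) hABC)
end

section
/- Theorem (Routh's formula, part a; Routh's Theorem). Assume 1 + d + d·e ≠ 0, 1 + e + e·f ≠ 0, 1 + f + f·d ≠ 0. Suppose P lies on both line AD and line BE, Q lies on both line BE and line CF, and R lies on both line CF and line AD, where in each case the two lines are non-parallel (their direction vectors are linearly independent). Then signedArea(P, Q, R) = signedArea(A, B, C) · (d·e·f − 1)² / ((1 + d + d·e)·(1 + e + e·f)·(1 + f + f·d)). -/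
/-- The signed area of the triangle with vertices `P`, `Q`, `R` in `ℝ × ℝ`. -/
noncomputable def signedArea (P Q R : ℝ × ℝ) : ℝ :=
  ((Q.1 - P.1) * (R.2 - P.2) - (Q.2 - P.2) * (R.1 - P.1)) / 2

theorem mem_line_iff {P Q X : ℝ × ℝ} : X ∈ line P Q ↔ ∃ t : ℝ, P + t • (Q - P) = X := by
  simp [line, mem_affineSpan_pair_iff_exists_lineMap_eq, AffineMap.lineMap_apply, add_comm]

/-- Two non-parallel lines `AD` and `BE` have at most one common point. -/
theorem eq_of_mem_lines {A B D E X Y : ℝ × ℝ} (h : LinearIndependent ℝ ![D - A, E - B])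
    (hXA : X ∈ line A D) (hXB : X ∈ line B E) (hYA : Y ∈ line A D) (hYB : Y ∈ line B E) :
    X = Y := by
  rw [mem_line_iff] at hXA hXB hYA hYB
  obtain ⟨s, rfl⟩ := hXA
  obtain ⟨t, ht⟩ := hXB
  obtain ⟨s', rfl⟩ := hYA
  obtain ⟨t', ht'⟩ := hYB
  have key : (s - s') • (D - A) + (t' - t) • (E - B) = 0 := by
    linear_combination (norm := module) ht' - ht
  rw [sub_eq_zero.mp (LinearIndependent.pair_iff.mp h _ _ key).1]

/-- The barycentric coordinates of the intersection of the cevians `AD` and `BE`. -/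
theorem eq_of_mem_cevians {A B C D E P : ℝ × ℝ} {d e : ℝ} (hd : 1 + d ≠ 0) (he : 1 + e ≠ 0)
    (h : 1 + d + d * e ≠ 0) (hD : D = (1 + d)⁻¹ • (B + d • C))
    (hE : E = (1 + e)⁻¹ • (C + e • A)) (hPA : P ∈ line A D) (hPB : P ∈ line B E)
    (hDE : LinearIndependent ℝ ![D - A, E - B]) :
    P = (1 + d + d * e)⁻¹ • ((d * e) • A + B + d • C) := by
  refine eq_of_mem_lines hDE hPA hPB (mem_line_iff.mpr ⟨(1 + d) / (1 + d + d * e), ?_⟩)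
    (mem_line_iff.mpr ⟨d * (1 + e) / (1 + d + d * e), ?_⟩)
  · rw [hD]
    ext <;> simp <;> field_simp <;> ring
  · rw [hE]
    ext <;> simp <;> field_simp <;> ring

/-- **Routh's theorem (part a).** The triangle cut out by the cevian lines
`AD`, `BE`, `CF` has signed area
`signedArea A B C * (def - 1)² / ((1+d+de)(1+e+ef)(1+f+fd))`. -/
theorem routh_a (A B C : ℝ × ℝ) (hABC : AffineIndependent ℝ ![A, B, C])
    (d e f : ℝ) (hd : 1 + d ≠ 0) (he : 1 + e ≠ 0) (hf : 1 + f ≠ 0)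
    (h1 : 1 + d + d * e ≠ 0) (h2 : 1 + e + e * f ≠ 0) (h3 : 1 + f + f * d ≠ 0)
    (D E F : ℝ × ℝ)
    (hD : D = (1 + d)⁻¹ • (B + d • C))
    (hE : E = (1 + e)⁻¹ • (C + e • A))
    (hF : F = (1 + f)⁻¹ • (A + f • B))
    (P Q R : ℝ × ℝ)
    (hP : P ∈ line A D ∧ P ∈ line B E)
    (hQ : Q ∈ line B E ∧ Q ∈ line C F)
    (hR : R ∈ line C F ∧ R ∈ line A D)
    (hP' : LinearIndependent ℝ ![D - A, E - B])
    (hQ' : LinearIndependent ℝ ![E - B, F - C])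
    (hR' : LinearIndependent ℝ ![F - C, D - A]) :
    signedArea P Q R = signedArea A B C * (d * e * f - 1) ^ 2 /
      ((1 + d + d * e) * (1 + e + e * f) * (1 + f + f * d)) := by
  rw [eq_of_mem_cevians hd he h1 hD hE hP.1 hP.2 hP',
    eq_of_mem_cevians he hf h2 hE hF hQ.1 hQ.2 hQ',
    eq_of_mem_cevians hf hd h3 hF hD hR.1 hR.2 hR']
  simp only [signedArea, Prod.fst_add, Prod.snd_add, Prod.smul_fst, Prod.smul_snd, smul_eq_mul]
  generalize hu : 1 + d + d * e = u at h1 ⊢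
  generalize hv : 1 + e + e * f = v at h2 ⊢
  generalize hw : 1 + f + f * d = w at h3 ⊢
  field_simp
  subst hu hv hw
  ring
end

section
/- Theorem (Routh's formula, part b). signedArea(D, E, F) = signedArea(A, B, C) · (d·e·f + 1) / ((1 + d)·(1 + e)·(1 + f)). -/
/-- **Routh's formula (part b).** The triangle with vertices `D`, `E`, `F`
has signed area `signedArea A B C * (def + 1) / ((1+d)(1+e)(1+f))`. -/
theorem routh_b (A B C : ℝ × ℝ) (hABC : AffineIndependent ℝ ![A, B, C])
    (d e f : ℝ) (hd : 1 + d ≠ 0) (he : 1 + e ≠ 0) (hf : 1 + f ≠ 0)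
    (D E F : ℝ × ℝ)
    (hD : D = (1 + d)⁻¹ • (B + d • C))
    (hE : E = (1 + e)⁻¹ • (C + e • A))
    (hF : F = (1 + f)⁻¹ • (A + f • B)) :
    signedArea D E F = signedArea A B C * (d * e * f + 1) /
      ((1 + d) * (1 + e) * (1 + f)) := by
  subst hD hE hF
  simp only [signedArea, Prod.fst_add, Prod.snd_add, Prod.smul_fst, Prod.smul_snd, smul_eq_mul]
  field_simp
  ring
end

section
/- Theorem (Six-Point Routh formula, part a). Set D_A = 1 − a⁺·a⁻ + b⁻·(1 + a⁻) + c⁺·(1 + a⁺), D_B = 1 − b⁺·b⁻ + c⁻·(1 + b⁻) + a⁺·(1 + b⁺), D_C = 1 − c⁺·c⁻ + a⁻·(1 + c⁻) + b⁺·(1 + c⁺), and assume D_A ≠ 0, D_B ≠ 0, D_C ≠ 0. Suppose P lies on both line C⁺A⁻ and line A⁺B⁻, Q lies on both line A⁺B⁻ and line B⁺C⁻, and R lies on both line B⁺C⁻ and line C⁺A⁻, where in each case the two lines are non-parallel (their direction vectors are linearly independent). Then signedArea(P, Q, R) = signedArea(A, B, C) · (a⁺·b⁺·c⁺ + a⁻·b⁻·c⁻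 + a⁺·a⁻ + b⁺·b⁻ + c⁺·c⁻ − 1)² / (D_A · D_B · D_C). -/
theorem mem_line_iff_s6 {X U V : ℝ × ℝ} :
    X ∈ line U V ↔ ∃ r : ℝ, AffineMap.lineMap U V r = X :=
  mem_affineSpan_pair_iff_exists_lineMap_eq

/-- Two lines with linearly independent directions meet in at most one point. -/
theorem eq_of_mem_line_of_mem_line {U V W Z X Y : ℝ × ℝ}
    (h : LinearIndependent ℝ ![V - U, Z - W])
    (hX : X ∈ line U V) (hX' : X ∈ line W Z) (hY : Y ∈ line U V) (hY' : Y ∈ line W Z) :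
    X = Y := by
  obtain ⟨s, rfl⟩ := mem_line_iff_s6.1 hX
  obtain ⟨t, ht⟩ := mem_line_iff_s6.1 hX'
  obtain ⟨s', rfl⟩ := mem_line_iff_s6.1 hY
  obtain ⟨t', ht'⟩ := mem_line_iff_s6.1 hY'
  simp only [AffineMap.lineMap_apply_module'] at ht ht'
  have key : (s - s') • (V - U) + (t' - t) • (Z - W) = 0 := by
    linear_combination (norm := module) ht' - ht
  have hs : s = s' := sub_eq_zero.1 (LinearIndependent.pair_iff.1 h _ _ key).1
  rw [hs]

/-- Barycentric coordinates of the common point of the lines `C⁺A⁻` and `A⁺B⁻`. -/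
theorem inter_eq_barycentric (A B C : ℝ × ℝ) {ap am bm cp D : ℝ}
    (hap : 1 + ap ≠ 0) (ham : 1 + am ≠ 0) (hbm : 1 + bm ≠ 0) (hcp : 1 + cp ≠ 0)
    (hD : D = 1 - ap * am + bm * (1 + am) + cp * (1 + ap)) (hD0 : D ≠ 0)
    {Ap Am Bm Cp P : ℝ × ℝ}
    (hAp : Ap = (1 + ap)⁻¹ • (B + ap • C))
    (hAm : Am = (1 + am)⁻¹ • (C + am • B))
    (hBm : Bm = (1 + bm)⁻¹ • (A + bm • C))
    (hCp : Cp = (1 + cp)⁻¹ • (A + cp • B))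
    (hP : P ∈ line Cp Am ∧ P ∈ line Ap Bm)
    (hP' : LinearIndependent ℝ ![Am - Cp, Bm - Ap]) :
    P = D⁻¹ • ((1 - ap * am) • A + (am * bm + cp) • B + (cp * ap + bm) • C) := by
  refine eq_of_mem_line_of_mem_line hP' hP.1 hP.2
    (mem_line_iff_s6.2 ⟨(1 + am) * (cp * ap + bm) / D, ?_⟩)
    (mem_line_iff_s6.2 ⟨(1 + bm) * (1 - ap * am) / D, ?_⟩)
  all_goals
    subst hAp hAm hBm hCp
    rw [AffineMap.lineMap_apply_module]
    ext <;>
    · simp only [Prod.fst_add, Prod.snd_add, Prod.smul_fst, Prod.smul_snd, smul_eq_mul]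
      field_simp
      subst hD
      ring

/-- **Six-Point Routh formula, part a.** The triangle with edge-lines
`B⁺C⁻`, `C⁺A⁻`, `A⁺B⁻` has signed area
`signedArea A B C * (a⁺b⁺c⁺ + a⁻b⁻c⁻ + a⁺a⁻ + b⁺b⁻ + c⁺c⁻ - 1)² / (D_A D_B D_C)`. -/
theorem six_point_routh_a (A B C : ℝ × ℝ)
    (hABC : AffineIndependent ℝ ![A, B, C])
    (ap am bp bm cp cm : ℝ)
    (hap : 1 + ap ≠ 0) (ham : 1 + am ≠ 0) (hbp : 1 + bp ≠ 0)
    (hbm : 1 + bm ≠ 0) (hcp : 1 + cp ≠ 0) (hcm : 1 + cm ≠ 0)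
    (DA DB DC : ℝ)
    (hDA : DA = 1 - ap * am + bm * (1 + am) + cp * (1 + ap))
    (hDB : DB = 1 - bp * bm + cm * (1 + bm) + ap * (1 + bp))
    (hDC : DC = 1 - cp * cm + am * (1 + cm) + bp * (1 + cp))
    (hDA0 : DA ≠ 0) (hDB0 : DB ≠ 0) (hDC0 : DC ≠ 0)
    (Ap Am Bp Bm Cp Cm : ℝ × ℝ)
    (hAp : Ap = (1 + ap)⁻¹ • (B + ap • C))
    (hAm : Am = (1 + am)⁻¹ • (C + am • B))
    (hBp : Bp = (1 + bp)⁻¹ • (C + bp • A))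
    (hBm : Bm = (1 + bm)⁻¹ • (A + bm • C))
    (hCp : Cp = (1 + cp)⁻¹ • (A + cp • B))
    (hCm : Cm = (1 + cm)⁻¹ • (B + cm • A))
    (P Q R : ℝ × ℝ)
    (hP : P ∈ line Cp Am ∧ P ∈ line Ap Bm)
    (hQ : Q ∈ line Ap Bm ∧ Q ∈ line Bp Cm)
    (hR : R ∈ line Bp Cm ∧ R ∈ line Cp Am)
    (hP' : LinearIndependent ℝ ![Am - Cp, Bm - Ap])
    (hQ' : LinearIndependent ℝ ![Bm - Ap, Cm - Bp])
    (hR' : LinearIndependent ℝ ![Cm - Bp, Am - Cp]) :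
    signedArea P Q R = signedArea A B C *
      (ap * bp * cp + am * bm * cm + ap * am + bp * bm + cp * cm - 1) ^ 2 /
      (DA * DB * DC) := by
  have eP := inter_eq_barycentric A B C hap ham hbm hcp hDA hDA0 hAp hAm hBm hCp hP hP'
  have eQ := inter_eq_barycentric B C A hbp hbm hcm hap hDB hDB0 hBp hBm hCm hAp hQ hQ'
  have eR := inter_eq_barycentric C A B hcp hcm ham hbp hDC hDC0 hCp hCm hAm hBp hR hR'
  subst eP eQ eR
  simp only [signedArea, Prod.fst_add, Prod.snd_add, Prod.smul_fst, Prod.smul_snd, smul_eq_mul]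
  field_simp
  subst hDA hDB hDC
  ring
end

section
/- Theorem (Six-Point Routh formula, part b; Bényi–Ćurgus). Assume 1 + b⁻ + c⁺ ≠ 0, 1 + c⁻ + a⁺ ≠ 0, 1 + a⁻ + b⁺ ≠ 0. Suppose X is a point lying on both line BB⁻ and line CC⁺, Y is a point lying on both line CC⁻ and line AA⁺, and Z is a point lying on both line AA⁻ and line BB⁺, where in each case the two lines are non-parallel (their direction vectors are linearly independent). Then signedArea(X, Y, Z) = signedArea(A, B, C) · (a⁺·b⁺·c⁺ + a⁻·b⁻·c⁻ − a⁺·a⁻ − b⁺·b⁻ − c⁺·c⁻ + 1) / ((1 + b⁻ + c⁺)·(1 + c⁻ + a⁺)·(1 + a⁻ + b⁺)). -/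
/-- Two lines with linearly independent directions have at most one common point. -/
theorem eq_of_mem_affineSpan_pair_of_linearIndependent {k V : Type*} [Field k] [AddCommGroup V]
    [Module k V] {P Q R S X Y : V} (h : LinearIndependent k ![Q - P, S - R])
    (hX : X ∈ affineSpan k {P, Q}) (hX' : X ∈ affineSpan k {R, S})
    (hY : Y ∈ affineSpan k {P, Q}) (hY' : Y ∈ affineSpan k {R, S}) : X = Y := by
  obtain ⟨r, rfl⟩ := mem_affineSpan_pair_iff_exists_lineMap_eq.1 hX
  obtain ⟨u, hu⟩ := mem_affineSpan_pair_iff_exists_lineMap_eq.1 hX'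
  obtain ⟨r', rfl⟩ := mem_affineSpan_pair_iff_exists_lineMap_eq.1 hY
  obtain ⟨u', hu'⟩ := mem_affineSpan_pair_iff_exists_lineMap_eq.1 hY'
  simp only [AffineMap.lineMap_apply_module'] at hu hu' ⊢
  have key : (r - r') • (Q - P) + (u' - u) • (S - R) = 0 := by
    rw [sub_smul, sub_smul, eq_sub_of_add_eq hu, eq_sub_of_add_eq hu']
    abel
  rw [sub_eq_zero.1 (LinearIndependent.pair_iff.1 h _ _ key).1]

/-- The point with barycentric coordinates `1 : t : s` lies on the cevian from `B` to the point
dividing `AC` in the ratio `s`. -/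
theorem barycentric_mem_cevian {k V : Type*} [Field k] [AddCommGroup V] [Module k V]
    (A B C : V) {s t : k} (hs : 1 + s ≠ 0) (hst : 1 + s + t ≠ 0) :
    (1 + s + t)⁻¹ • (A + t • B + s • C) ∈ affineSpan k {B, (1 + s)⁻¹ • (A + s • C)} := by
  rw [mem_affineSpan_pair_iff_exists_lineMap_eq]
  refine ⟨(1 + s) / (1 + s + t), ?_⟩
  rw [AffineMap.lineMap_apply_module]
  match_scalars <;> field_simp
  ring

/-- Barycentric coordinates of the intersection of two cevians. -/
theorem eq_barycentric_of_mem_cevians {k V : Type*} [Field k] [AddCommGroup V] [Module k V]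
    {A B C P Q X : V} {s t : k} (hs : 1 + s ≠ 0) (ht : 1 + t ≠ 0) (hst : 1 + s + t ≠ 0)
    (hP : P = (1 + s)⁻¹ • (A + s • C)) (hQ : Q = (1 + t)⁻¹ • (A + t • B))
    (h : LinearIndependent k ![P - B, Q - C])
    (hX : X ∈ affineSpan k {B, P} ∧ X ∈ affineSpan k {C, Q}) :
    X = (1 + s + t)⁻¹ • (A + t • B + s • C) := by
  subst hP hQ
  refine eq_of_mem_affineSpan_pair_of_linearIndependent h hX.1 hX.2
    (barycentric_mem_cevian A B C hs hst) ?_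
  have := barycentric_mem_cevian A C B ht (t := s) (by rwa [add_right_comm])
  rwa [add_right_comm 1 t s, add_right_comm A] at this

/-- **Six-Point Routh formula, part b (Bényi–Ćurgus).** The triangle with
vertices `X = BB⁻ ∩ CC⁺`, `Y = CC⁻ ∩ AA⁺`, `Z = AA⁻ ∩ BB⁺` has signed area
`signedArea A B C * (a⁺b⁺c⁺ + a⁻b⁻c⁻ - a⁺a⁻ - b⁺b⁻ - c⁺c⁻ + 1) /
  ((1+b⁻+c⁺)(1+c⁻+a⁺)(1+a⁻+b⁺))`. -/
theorem six_point_routh_b (A B C : ℝ × ℝ)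
    (hABC : AffineIndependent ℝ ![A, B, C])
    (ap am bp bm cp cm : ℝ)
    (hap : 1 + ap ≠ 0) (ham : 1 + am ≠ 0) (hbp : 1 + bp ≠ 0)
    (hbm : 1 + bm ≠ 0) (hcp : 1 + cp ≠ 0) (hcm : 1 + cm ≠ 0)
    (h1 : 1 + bm + cp ≠ 0) (h2 : 1 + cm + ap ≠ 0) (h3 : 1 + am + bp ≠ 0)
    (Ap Am Bp Bm Cp Cm : ℝ × ℝ)
    (hAp : Ap = (1 + ap)⁻¹ • (B + ap • C))
    (hAm : Am = (1 + am)⁻¹ • (C + am • B))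
    (hBp : Bp = (1 + bp)⁻¹ • (C + bp • A))
    (hBm : Bm = (1 + bm)⁻¹ • (A + bm • C))
    (hCp : Cp = (1 + cp)⁻¹ • (A + cp • B))
    (hCm : Cm = (1 + cm)⁻¹ • (B + cm • A))
    (X Y Z : ℝ × ℝ)
    (hX : X ∈ line B Bm ∧ X ∈ line C Cp)
    (hY : Y ∈ line C Cm ∧ Y ∈ line A Ap)
    (hZ : Z ∈ line A Am ∧ Z ∈ line B Bp)
    (hX' : LinearIndependent ℝ ![Bm - B, Cp - C])
    (hY' : LinearIndependent ℝ ![Cm - C, Ap - A])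
    (hZ' : LinearIndependent ℝ ![Am - A, Bp - B]) :
    signedArea X Y Z = signedArea A B C *
      (ap * bp * cp + am * bm * cm - ap * am - bp * bm - cp * cm + 1) /
      ((1 + bm + cp) * (1 + cm + ap) * (1 + am + bp)) := by
  rw [eq_barycentric_of_mem_cevians hbm hcp h1 hBm hCp hX' hX,
    eq_barycentric_of_mem_cevians hcm hap h2 hCm hAp hY' hY,
    eq_barycentric_of_mem_cevians ham hbp h3 hAm hBp hZ' hZ]
  simp only [signedArea, Prod.fst_add, Prod.snd_add, Prod.smul_fst, Prod.smul_snd, smul_eq_mul]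
  field_simp
  ring
end

section
/- Lemma (vertex formula for the Bényi–Ćurgus triangle). Assume 1 + c⁺ + b⁻ ≠ 0. Then the point X = (1 + c⁺ + b⁻)⁻¹ • (A + c⁺ • B + b⁻ • C) lies on the line through B and B⁻ and also on the line through C and C⁺. -/
/-- **Vertex formula for the Bényi–Ćurgus triangle.** The point
`X = (1 + c⁺ + b⁻)⁻¹ • (A + c⁺ • B + b⁻ • C)` lies on line `BB⁻` and
on line `CC⁺`. -/
theorem benyi_curgus_vertex (A B C : ℝ × ℝ)
    (hABC : AffineIndependent ℝ ![A, B, C])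
    (bm cp : ℝ) (hbm : 1 + bm ≠ 0) (hcp : 1 + cp ≠ 0)
    (h : 1 + cp + bm ≠ 0)
    (Bm Cp : ℝ × ℝ)
    (hBm : Bm = (1 + bm)⁻¹ • (A + bm • C))
    (hCp : Cp = (1 + cp)⁻¹ • (A + cp • B))
    (X : ℝ × ℝ)
    (hX : X = (1 + cp + bm)⁻¹ • (A + cp • B + bm • C)) :
    X ∈ line B Bm ∧ X ∈ line C Cp := by
  subst hBm hCp hX
  constructor
  · have key : (1 + cp + bm)⁻¹ • (A + cp • B + bm • C) =
        AffineMap.lineMap B ((1 + bm)⁻¹ • (A + bm • C)) ((1 + bm) / (1 + cp + bm)) := by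
      rw [AffineMap.lineMap_apply_module]
      match_scalars <;> field_simp <;> ring
    rw [key]
    exact AffineMap.lineMap_mem_affineSpan_pair _ _ _
  · have key : (1 + cp + bm)⁻¹ • (A + cp • B + bm • C) =
        AffineMap.lineMap C ((1 + cp)⁻¹ • (A + cp • B)) ((1 + cp) / (1 + cp + bm)) := by
      rw [AffineMap.lineMap_apply_module]
      match_scalars <;> field_simp <;> ring
    rw [key]
    exact AffineMap.lineMap_mem_affineSpan_pair _ _ _
end

section
/- Lemma (vertex formula for the six-point Routh triangle). Set D_A = 1 − a⁻·a⁺ + b⁻·(1 + a⁻) + c⁺·(1 + a⁺) and assume D_A ≠ 0. Then the point P = D_A⁻¹ • ((1 − a⁻·a⁺) • A + (c⁺ + a⁻·b⁻) • B + (b⁻ + a⁺·c⁺) • C) lies on the line through A⁺ and B⁻ and also on the line through C⁺ and A⁻ (assuming A⁺ ≠ B⁻ and C⁺ ≠ A⁻). -/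
/-- A weighted mean of two points, with weights of nonzero sum, lies on the line through them. -/
theorem inv_smul_add_mem_line {P Q : ℝ × ℝ} {x y d : ℝ} (hd : d ≠ 0) (h : x + y = d) :
    d⁻¹ • (x • P + y • Q) ∈ line P Q := by
  unfold line
  convert AffineMap.lineMap_mem_affineSpan_pair (y / d) P Q using 1
  rw [AffineMap.lineMap_apply_module, smul_add, smul_smul, smul_smul]
  congr 2
  · field_simp
    linarith
  · ring

/-- **Vertex formula for the six-point Routh triangle.** The point
`P = D_A⁻¹ • ((1 - a⁻a⁺) • A + (c⁺ + a⁻b⁻) • B + (b⁻ + a⁺c⁺) • C)` lies on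
line `A⁺B⁻` and on line `C⁺A⁻`. -/
theorem six_point_routh_vertex (A B C : ℝ × ℝ)
    (hABC : AffineIndependent ℝ ![A, B, C])
    (ap am bm cp : ℝ)
    (hap : 1 + ap ≠ 0) (ham : 1 + am ≠ 0) (hbm : 1 + bm ≠ 0) (hcp : 1 + cp ≠ 0)
    (DA : ℝ) (hDA : DA = 1 - am * ap + bm * (1 + am) + cp * (1 + ap))
    (hDA0 : DA ≠ 0)
    (Ap Am Bm Cp : ℝ × ℝ)
    (hAp : Ap = (1 + ap)⁻¹ • (B + ap • C))
    (hAm : Am = (1 + am)⁻¹ • (C + am • B))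
    (hBm : Bm = (1 + bm)⁻¹ • (A + bm • C))
    (hCp : Cp = (1 + cp)⁻¹ • (A + cp • B))
    (hne1 : Ap ≠ Bm) (hne2 : Cp ≠ Am)
    (P : ℝ × ℝ)
    (hP : P = DA⁻¹ • ((1 - am * ap) • A + (cp + am * bm) • B + (bm + ap * cp) • C)) :
    P ∈ line Ap Bm ∧ P ∈ line Cp Am := by
  constructor
  · have h := inv_smul_add_mem_line (P := Ap) (Q := Bm)
      (x := (cp + am * bm) * (1 + ap)) (y := (1 - am * ap) * (1 + bm)) hDA0 (by rw [hDA]; ring)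
    convert h using 1
    rw [hP, hAp, hBm, mul_smul, mul_smul, smul_inv_smul₀ hap, smul_inv_smul₀ hbm]
    module
  · have h := inv_smul_add_mem_line (P := Cp) (Q := Am)
      (x := (1 - am * ap) * (1 + cp)) (y := (bm + ap * cp) * (1 + am)) hDA0 (by rw [hDA]; ring)
    convert h using 1
    rw [hP, hCp, hAm, mul_smul, mul_smul, smul_inv_smul₀ hcp, smul_inv_smul₀ ham]
    module
end
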